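/- There is no finitely generated group containing a copy of every countable group: it is not the case that there exists a group H with Group.FG H such that for every countable group G there is an injective group homomorphism G →* H. -/

import Mathlib

/-- Fibrewise permutation of ℤ × Fin 3. -/
def nuFib (σ : ℤ → Equiv.Perm (Fin 3)) : Equiv.Perm (ℤ × Fin 3) := Equiv.prodCongrRight σ

/-- The shift. -/
def nuShift (n : ℤ) : Equiv.Perm (ℤ × Fin 3) :=
  Equiv.prodCongr (Equiv.addRight n) (Equiv.refl _)

theorem nuShift_zpow (n : ℤ) : nuShift 1 ^ n = nuShift n := by
  let φ : Multiplicative ℤ →* Equiv.Perm (ℤ × Fin 3) :=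
    { toFun := fun n => nuShift n.toAdd
      map_one' := by ext x <;> simp [nuShift]
      map_mul' := fun a b => by
        ext x <;> simp [nuShift]
        ring }
  have := map_zpow φ (Multiplicative.ofAdd 1) n
  rw [← ofAdd_zsmul] at this
  simpa [φ] using this.symm

theorem nuShift_inv (n : ℤ) : (nuShift n)⁻¹ = nuShift (-n) := by
  rw [← nuShift_zpow n, ← nuShift_zpow (-n), zpow_neg]

theorem nu_conj (σ : ℤ → Equiv.Perm (Fin 3)) (n : ℤ) :
    (nuShift 1 ^ n)⁻¹ * nuFib σ * nuShift 1 ^ n = nuFib (fun m => σ (m + n)) := by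
  rw [nuShift_zpow, nuShift_inv]
  ext x <;> simp [nuShift, nuFib]

theorem nu_key (S : Set ℤ) : ∃ f g t : Equiv.Perm (ℤ × Fin 3), ∀ n : ℤ,
    (Commute f ((t ^ n)⁻¹ * g * t ^ n) ↔ n ∈ S) := by
  classical
  refine ⟨nuFib (fun m => if m = 0 then Equiv.swap 0 1 else 1),
    nuFib (fun m => if m ∈ S then 1 else Equiv.swap 1 2), nuShift 1, fun n => ?_⟩
  rw [nu_conj]
  constructor
  · intro h
    by_contra hn
    have := congrArg (fun e : Equiv.Perm (ℤ × Fin 3) => (e (0, 0)).2) h.eq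
    simp [nuFib, hn] at this
    revert this
    decide
  · intro hn
    refine Equiv.ext fun ⟨m, i⟩ => ?_
    by_cases hm : m = 0
    · subst hm
      simp [nuFib, hn]
    · simp [nuFib, hm]

theorem nu_countable_of_fg (H : Type*) [Group H] (h : Group.FG H) : Countable H := by
  obtain ⟨S, hS⟩ := Group.fg_def.1 h
  have hs : Function.Surjective (FreeGroup.lift (fun x : S => (x : H))) := by
    rw [← MonoidHom.range_eq_top, FreeGroup.range_lift_eq_closure]
    simpa using hS
  have : Countable (FreeGroup S) := by
    unfold FreeGroup
    infer_instance
  exact hs.countable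

/-- There is no finitely generated group containing a copy of every countable group. -/
theorem no_universal_fg_group_for_countable_groups :
    ¬ ∃ (H : Type u) (_ : Group H), Group.FG H ∧
      ∀ (G : Type) (_ : Group G), Countable G →
        ∃ i : G →* H, Function.Injective i := by
  rintro ⟨H, _, hH, hu⟩
  have hc := nu_countable_of_fg H hH
  have key : ∀ S : Set ℤ, ∃ p : H × H × H, ∀ n : ℤ,
      (Commute p.1 ((p.2.2 ^ n)⁻¹ * p.2.1 * p.2.2 ^ n) ↔ n ∈ S) := by
    intro S
    classical
    obtain ⟨f, g, t, h⟩ := nu_key S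
    let K := Subgroup.closure ({f, g, t} : Set (Equiv.Perm (ℤ × Fin 3)))
    have hf : f ∈ K := Subgroup.subset_closure (by simp)
    have hg : g ∈ K := Subgroup.subset_closure (by simp)
    have ht : t ∈ K := Subgroup.subset_closure (by simp)
    have hK : Group.FG K :=
      (Group.fg_iff_subgroup_fg K).2 ⟨{f, g, t}, by simp [K]⟩
    obtain ⟨i, hi⟩ := hu K inferInstance (nu_countable_of_fg K hK)
    refine ⟨(i ⟨f, hf⟩, i ⟨g, hg⟩, i ⟨t, ht⟩), fun n => ?_⟩
    rw [← h n]
    simp only [← map_zpow, ← map_inv, ← map_mul, Commute, SemiconjBy, hi.eq_iff]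
    simp [Subtype.ext_iff]
  choose p hp using key
  have hinj : Function.Injective p := by
    intro S T hST
    ext n
    rw [← hp S n, ← hp T n, hST]
  have : Countable (Set ℤ) := hinj.countable
  obtain ⟨e, he⟩ := exists_injective_nat (Set ℤ)
  exact Function.cantor_injective (fun s => (e s : ℤ)) (fun a b h => he (by simpa using h))
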